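/- arXiv:2508.08324 — 2 statements merged into one kernel-verified Lean document; each statement's English description precedes it below -/
import Mathlib

section
/- Let G be a finite graph and V₁, V₂ disjoint connected vertex subsets. Let b(V₁,V₂) be the number of edges of G with one endpoint in V₁ and the other in V₂. Then the number of spanning trees of the induced subgraph on V₁ ∪ V₂ satisfies H(V₁ ∪ V₂) ≤ H(V₁)·H(V₂)·exp(b(V₁,V₂)·(log|V₁| + log|V₂| + log 2)), where H(V) is the number of spanning trees of the induced connected subgraph on V (and if V₁ ∪ V₂ is disconnected, H(V₁ ∪ V₂) := H(V₁)·H(V₂)). -/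
/-- `T` is a maximal spanning forest of the subgraph of `G` induced on `V`:
a subgraph of `G` with vertex set exactly `V`, acyclic, and realizing the same
reachability relation on `V` as `G[V]` (so it restricts to a spanning tree of
each connected component of `G[V]`).  The number of such forests equals the
product, over the connected components of `G[V]`, of the number of spanning
trees of the component. -/
def IsMaxSpanningForestOn {α : Type*} (G : SimpleGraph α) (V : Set α)
    (T : G.Subgraph) : Prop :=
  T.verts = V ∧ T.spanningCoe.IsAcyclic ∧
    ∀ x ∈ V, ∀ y ∈ V,
      (T.spanningCoe.Reachable x y ↔
        ((⊤ : G.Subgraph).induce V).spanningCoe.Reachable x y)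

/-- `H(V)`, defined multiplicatively over the connected components of `G[V]`:
the number of maximal spanning forests of `G[V]`. -/
noncomputable def numSpanningForests {α : Type*} (G : SimpleGraph α) (V : Set α) : ℕ :=
  Nat.card {T : G.Subgraph // IsMaxSpanningForestOn G V T}

/-- `b(V,W)`: the number of edges of `G` with one endpoint in `V` and the other
in `W` (for disjoint `V`, `W`, each such edge corresponds to a unique ordered
pair). -/
noncomputable def crossEdges {α : Type*} (G : SimpleGraph α) (V W : Set α) : ℕ :=
  Set.ncard {p : α × α | p.1 ∈ V ∧ p.2 ∈ W ∧ G.Adj p.1 p.2}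

namespace SimpleGraph

variable {α : Type*}

/-- The maximal spanning forests of `K`, as a set of graphs on the same vertex type. -/
def maxForests (K : SimpleGraph α) : Set (SimpleGraph α) :=
  {T | T ≤ K ∧ T.IsAcyclic ∧ ∀ x y, K.Adj x y → T.Reachable x y}

/-- Reachability in `K` implies reachability in `T` as soon as it does so for adjacent vertices. -/
lemma Reachable.of_forall_adj {K T : SimpleGraph α}
    (h : ∀ x y, K.Adj x y → T.Reachable x y) {x y : α} (hxy : K.Reachable x y) :
    T.Reachable x y := by
  obtain ⟨p⟩ := hxy
  induction p with
  | nil => exact .refl _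
  | cons hadj _ ih => exact (h _ _ hadj).trans ih

/-- A path using one additional edge can be split at this edge. -/
lemma Reachable.split_sup_edge {T : SimpleGraph α} {u v x y : α}
    (h : (T ⊔ edge u v).Reachable x y) :
    T.Reachable x y ∨ (T.Reachable x u ∧ T.Reachable v y) ∨
      (T.Reachable x v ∧ T.Reachable u y) := by
  obtain ⟨p⟩ := h
  induction p with
  | nil => exact .inl (.refl _)
  | cons hadj _ ih =>
    rw [sup_adj, edge_adj] at hadj
    rcases hadj with hadj | ⟨⟨rfl, rfl⟩ | ⟨rfl, rfl⟩, -⟩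
    · rcases ih with ih | ⟨h1, h2⟩ | ⟨h1, h2⟩
      · exact .inl (hadj.reachable.trans ih)
      · exact .inr (.inl ⟨hadj.reachable.trans h1, h2⟩)
      · exact .inr (.inr ⟨hadj.reachable.trans h1, h2⟩)
    · rcases ih with ih | ⟨h1, h2⟩ | ⟨h1, h2⟩
      · exact .inr (.inl ⟨.refl _, ih⟩)
      · exact .inr (.inl ⟨.refl _, h2⟩)
      · exact .inl h2
    · rcases ih with ih | ⟨h1, h2⟩ | ⟨h1, h2⟩
      · exact .inr (.inr ⟨.refl _, ih⟩)
      · exact .inl h2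
      · exact .inr (.inr ⟨.refl _, h2⟩)

lemma deleteEdges_sup_edge_of_adj {T : SimpleGraph α} {u v : α} (h : T.Adj u v) :
    T.deleteEdges {s(u, v)} ⊔ edge u v = T := by
  ext a b
  have := h.symm
  have := h.ne
  simp only [sup_adj, deleteEdges_adj, edge_adj, Set.mem_singleton_iff, Sym2.eq_iff]
  grind

lemma sup_edge_deleteEdges_of_not_adj {T : SimpleGraph α} {u v : α} (h : ¬T.Adj u v) :
    (T ⊔ edge u v).deleteEdges {s(u, v)} = T := by
  ext a b
  have := fun h' : T.Adj v u => h h'.symm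
  simp only [sup_adj, deleteEdges_adj, edge_adj, Set.mem_singleton_iff, Sym2.eq_iff]
  grind

lemma IsAcyclic.not_reachable_deleteEdges {T : SimpleGraph α} (hT : T.IsAcyclic) {u v : α}
    (h : T.Adj u v) : ¬(T.deleteEdges {s(u, v)}).Reachable u v :=
  isBridge_iff.1 (isAcyclic_iff_forall_isBridge.1 hT h)

lemma deleteEdges_le_deleteEdges {T K : SimpleGraph α} (h : T ≤ K) (s : Set (Sym2 α)) :
    T.deleteEdges s ≤ K.deleteEdges s := fun _ _ hab => by
  rw [deleteEdges_adj] at hab ⊢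
  exact ⟨h hab.1, hab.2⟩

/-- A maximal spanning forest avoiding an edge is one of the graph with this edge deleted. -/
lemma mem_maxForests_deleteEdges {K T : SimpleGraph α} (hT : T ∈ maxForests K) {u v : α}
    (h : ¬T.Adj u v) : T ∈ maxForests (K.deleteEdges {s(u, v)}) := by
  refine ⟨fun a b hab => ?_, hT.2.1, fun a b hab => hT.2.2 a b (K.deleteEdges_le _ hab)⟩
  rw [deleteEdges_adj]
  refine ⟨hT.1 hab, fun he => h ?_⟩
  rw [← mem_edgeSet, ← Set.mem_singleton_iff.1 he]
  exact hab

/-- Exchange of an edge which is not a bridge in a maximal spanning forest. -/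
lemma exists_maxForests_exchange {K T : SimpleGraph α} (hT : T ∈ maxForests K) {u v : α}
    (huv : T.Adj u v) (hK : (K.deleteEdges {s(u, v)}).Reachable u v) :
    ∃ T' ∈ maxForests (K.deleteEdges {s(u, v)}), ∃ f ∈ T'.edgeSet,
      T'.deleteEdges {f} ⊔ edge u v = T := by
  set T₀ := T.deleteEdges {s(u, v)} with hT₀
  have hn : ¬T₀.Reachable u v := hT.2.1.not_reachable_deleteEdges huv
  have hT_eq : T₀ ⊔ edge u v = T := deleteEdges_sup_edge_of_adj huv
  obtain ⟨x, y, hxy, hnxy⟩ :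
      ∃ x y, (K.deleteEdges {s(u, v)}).Adj x y ∧ ¬T₀.Reachable x y := by
    by_contra! hcon
    exact hn (hK.of_forall_adj hcon)
  have hxyT : (T₀ ⊔ edge u v).Reachable x y := by
    rw [hT_eq]
    exact hT.2.2 x y (K.deleteEdges_le _ hxy)
  have hadj : (T₀ ⊔ edge x y).Adj x y := by
    rw [sup_adj, edge_adj]
    exact .inr ⟨.inl ⟨rfl, rfl⟩, hxy.ne⟩
  have hle : T₀ ≤ T₀ ⊔ edge x y := le_sup_left
  have huv' : (T₀ ⊔ edge x y).Reachable u v := by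
    rcases hxyT.split_sup_edge with h | ⟨h1, h2⟩ | ⟨h1, h2⟩
    · exact absurd h hnxy
    · exact ((h1.symm.mono hle).trans hadj.reachable).trans (h2.symm.mono hle)
    · exact ((h2.mono hle).trans hadj.reachable.symm).trans (h1.mono hle)
  refine ⟨T₀ ⊔ edge x y, ⟨?_, hT.2.1.anti (T.deleteEdges_le _) |>.sup_edge_of_not_reachable hnxy,
    fun a b hab => ?_⟩, s(x, y), hadj, ?_⟩
  · exact sup_le (deleteEdges_le_deleteEdges hT.1 _) ((edge_le_iff _).2 (.inr hxy))
  · refine (hT.2.2 a b (K.deleteEdges_le _ hab)).of_forall_adj fun c d hcd => ?_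
    rw [← hT_eq, sup_adj, edge_adj] at hcd
    rcases hcd with hcd | ⟨⟨rfl, rfl⟩ | ⟨rfl, rfl⟩, -⟩
    · exact hcd.reachable.mono hle
    · exact huv'
    · exact huv'.symm
  · rw [sup_edge_deleteEdges_of_not_adj fun h => hnxy h.reachable, hT_eq]

/-- A nonempty finite vertex set containing all edges of a forest has more elements than
the forest has edges. -/
lemma IsAcyclic.ncard_edgeSet_lt [Finite α] {T : SimpleGraph α} (hT : T.IsAcyclic) {V : Set α}
    (hV : V.Nonempty) (hTV : ∀ x y, T.Adj x y → x ∈ V) : T.edgeSet.ncard + 1 ≤ V.ncard := by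
  classical
  have := hV.to_subtype
  have := Fintype.ofFinite V
  obtain ⟨F, hF, -, hFtree⟩ :=
    (connected_top (V := V)).exists_isTree_le_of_le_of_isAcyclic le_top (hT.induce V)
  have hsub : T.edgeSet ⊆ Sym2.map Subtype.val '' F.edgeSet := by
    intro e
    induction e with | h x y =>
    intro h
    exact ⟨s(⟨x, hTV _ _ h⟩, ⟨y, hTV _ _ h.symm⟩), hF (by simpa using h), rfl⟩
  calc T.edgeSet.ncard + 1 ≤ F.edgeSet.ncard + 1 := by
        gcongr
        exact (Set.ncard_le_ncard hsub).trans (Set.ncard_image_le)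
    _ = V.ncard := by
        rw [← Nat.card_coe_set_eq V, Nat.card_eq_fintype_card, ← hFtree.card_edgeFinset,
          ← coe_edgeFinset, Set.ncard_coe_finset]

/-- Deleting an edge divides the number of maximal spanning forests at most by the number of
vertices. -/
lemma ncard_maxForests_le_deleteEdges [Finite α] {K : SimpleGraph α} {V : Set α}
    (hV : V.Nonempty) (hKV : ∀ x y, K.Adj x y → x ∈ V) (e : Sym2 α) :
    (maxForests K).ncard ≤ V.ncard * (maxForests (K.deleteEdges {e})).ncard := by
  classical
  induction e with | h u v =>
  have hpos : 1 ≤ V.ncard := (Set.ncard_pos).2 hV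
  by_cases hK : (K.deleteEdges {s(u, v)}).Reachable u v
  · set S := (Set.toFinite (maxForests (K.deleteEdges {s(u, v)}))).toFinset with hS
    have hsub : maxForests K ⊆ (S.biUnion fun T' => insert T'
        ((Set.toFinite T'.edgeSet).toFinset.image fun f => T'.deleteEdges {f} ⊔ edge u v) :
          Finset (SimpleGraph α)) := by
      intro T hT
      simp only [Finset.coe_biUnion, Set.mem_iUnion, Finset.mem_coe, hS, Set.Finite.mem_toFinset,
        Finset.mem_insert, Finset.mem_image, exists_prop]
      by_cases huv : T.Adj u v
      · obtain ⟨T', hT', f, hf, h⟩ := exists_maxForests_exchange hT huv hK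
        exact ⟨T', hT', .inr ⟨f, hf, h⟩⟩
      · exact ⟨T, mem_maxForests_deleteEdges hT huv, .inl rfl⟩
    have hcard := Set.ncard_le_ncard hsub
    rw [Set.ncard_coe_finset] at hcard
    refine hcard.trans ?_
    rw [Set.ncard_eq_toFinset_card _ (Set.toFinite (maxForests (K.deleteEdges {s(u, v)}))),
      mul_comm]
    refine Finset.card_biUnion_le_card_mul _ _ _ fun T' hT' => ?_
    rw [hS, Set.Finite.mem_toFinset] at hT'
    refine (Finset.card_insert_le _ _).trans ?_
    refine le_trans ?_ (hT'.2.1.ncard_edgeSet_lt hV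
      fun x y h => hKV x y (K.deleteEdges_le _ (hT'.1 h)))
    gcongr
    rw [Set.ncard_eq_toFinset_card _ (Set.toFinite T'.edgeSet)]
    exact Finset.card_image_le
  · refine le_trans ?_ (Nat.le_mul_of_pos_left _ hpos)
    by_cases huv : K.Adj u v
    · have hsub : maxForests K ⊆
          (fun T => T ⊔ edge u v) '' maxForests (K.deleteEdges {s(u, v)}) := by
        intro T hT
        have hadj : T.Adj u v := by
          by_contra hn
          exact hK ((hT.2.2 u v huv).mono (mem_maxForests_deleteEdges hT hn).1)
        refine ⟨T.deleteEdges {s(u, v)}, ⟨deleteEdges_le_deleteEdges hT.1 _,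
          hT.2.1.anti (T.deleteEdges_le _), fun a b hab => ?_⟩, deleteEdges_sup_edge_of_adj hadj⟩
        have h := hT.2.2 a b (K.deleteEdges_le _ hab)
        rw [← deleteEdges_sup_edge_of_adj hadj] at h
        have hle : T.deleteEdges {s(u, v)} ≤ K.deleteEdges {s(u, v)} :=
          deleteEdges_le_deleteEdges hT.1 _
        rcases h.split_sup_edge with h | ⟨h1, h2⟩ | ⟨h1, h2⟩
        · exact h
        · exact absurd (((h1.symm.mono hle).trans hab.reachable).trans (h2.symm.mono hle)) hK
        · exact absurd (((h2.mono hle).trans hab.reachable.symm).trans (h1.mono hle)) hK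
      exact (Set.ncard_le_ncard hsub).trans Set.ncard_image_le
    · exact Set.ncard_le_ncard fun T hT => mem_maxForests_deleteEdges hT fun h => huv (hT.1 h)

lemma ncard_maxForests_le_deleteEdges_finset [Finite α] {K : SimpleGraph α} {V : Set α}
    (hV : V.Nonempty) (hKV : ∀ x y, K.Adj x y → x ∈ V) (s : Finset (Sym2 α)) :
    (maxForests K).ncard ≤ V.ncard ^ s.card * (maxForests (K.deleteEdges s)).ncard := by
  classical
  induction s using Finset.induction_on with
  | empty => simp
  | insert e s he ih =>
    have h := ncard_maxForests_le_deleteEdges (K := K.deleteEdges s) hV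
      (fun x y h => hKV x y (K.deleteEdges_le _ h)) e
    rw [deleteEdges_deleteEdges, Set.union_singleton] at h
    rw [Finset.card_insert_of_notMem he, pow_succ, Finset.coe_insert, mul_assoc]
    exact ih.trans (Nat.mul_le_mul_left _ h)

/-- Reachability in a union of two graphs with disjoint supports. -/
lemma Reachable.inf_of_le_sup {T K₁ K₂ : SimpleGraph α} {V₁ V₂ : Set α}
    (hdisj : Disjoint V₁ V₂) (h1 : ∀ x y, K₁.Adj x y → x ∈ V₁)
    (h2 : ∀ x y, K₂.Adj x y → x ∈ V₂) (hT : T ≤ K₁ ⊔ K₂) {x y : α} (hx : x ∈ V₁)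
    (h : T.Reachable x y) : (T ⊓ K₁).Reachable x y := by
  obtain ⟨p⟩ := h
  induction p with
  | nil => exact .refl _
  | cons hadj _ ih =>
    rcases hT hadj with h | h
    · exact (show (T ⊓ K₁).Adj _ _ from ⟨hadj, h⟩).reachable.trans (ih (h1 _ _ h.symm))
    · exact absurd (h2 _ _ h) (Set.disjoint_left.1 hdisj hx)

lemma inf_mem_maxForests {T K₁ K₂ : SimpleGraph α} {V₁ V₂ : Set α}
    (hdisj : Disjoint V₁ V₂) (h1 : ∀ x y, K₁.Adj x y → x ∈ V₁)
    (h2 : ∀ x y, K₂.Adj x y → x ∈ V₂) (hT : T ∈ maxForests (K₁ ⊔ K₂)) :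
    T ⊓ K₁ ∈ maxForests K₁ :=
  ⟨inf_le_right, hT.2.1.anti inf_le_left, fun x y h =>
    (hT.2.2 x y (.inl h)).inf_of_le_sup hdisj h1 h2 hT.1 (h1 _ _ h)⟩

lemma ncard_maxForests_sup_le [Finite α] {K₁ K₂ : SimpleGraph α} {V₁ V₂ : Set α}
    (hdisj : Disjoint V₁ V₂) (h1 : ∀ x y, K₁.Adj x y → x ∈ V₁)
    (h2 : ∀ x y, K₂.Adj x y → x ∈ V₂) :
    (maxForests (K₁ ⊔ K₂)).ncard ≤ (maxForests K₁).ncard * (maxForests K₂).ncard := by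
  rw [← Set.ncard_prod]
  refine Set.ncard_le_ncard_of_injOn (fun T => (T ⊓ K₁, T ⊓ K₂)) (fun T hT => ?_)
    (fun T hT T' hT' h => ?_)
  · exact ⟨inf_mem_maxForests hdisj h1 h2 hT,
      inf_mem_maxForests hdisj.symm h2 h1 (by rwa [sup_comm])⟩
  · obtain ⟨h₁, h₂⟩ := Prod.ext_iff.1 h
    dsimp only at h₁ h₂
    rw [← inf_eq_left.2 hT.1, ← inf_eq_left.2 hT'.1, inf_sup_left, inf_sup_left, h₁, h₂]

end SimpleGraph

open SimpleGraph

lemma spanningCoe_induce_top_adj {α : Type*} {G : SimpleGraph α} {V : Set α} {x y : α} :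
    ((⊤ : G.Subgraph).induce V).spanningCoe.Adj x y ↔ x ∈ V ∧ y ∈ V ∧ G.Adj x y := by
  simp

lemma isMaxSpanningForestOn_iff {α : Type*} {G : SimpleGraph α} {V : Set α} {T : G.Subgraph} :
    IsMaxSpanningForestOn G V T ↔
      T.verts = V ∧ T.spanningCoe ∈ maxForests ((⊤ : G.Subgraph).induce V).spanningCoe := by
  refine and_congr_right fun hV => ?_
  have hle : T.spanningCoe ≤ ((⊤ : G.Subgraph).induce V).spanningCoe := fun x y h => by
    rw [spanningCoe_induce_top_adj, ← hV]
    exact ⟨T.edge_vert h, T.edge_vert h.symm, T.adj_sub h⟩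
  constructor
  · rintro ⟨hac, hr⟩
    refine ⟨hle, hac, fun x y h => ?_⟩
    have h' := spanningCoe_induce_top_adj.1 h
    exact (hr x h'.1 y h'.2.1).2 h.reachable
  · rintro ⟨-, hac, hr⟩
    exact ⟨hac, fun x _ y _ => ⟨fun h => h.mono hle, fun h => h.of_forall_adj hr⟩⟩

lemma numSpanningForests_eq_ncard {α : Type*} (G : SimpleGraph α) (V : Set α) :
    numSpanningForests G V =
      (maxForests ((⊤ : G.Subgraph).induce V).spanningCoe).ncard := by
  rw [numSpanningForests, ← Nat.card_coe_set_eq]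
  refine Nat.card_congr
    { toFun := fun T => ⟨T.1.spanningCoe, (isMaxSpanningForestOn_iff.1 T.2).2⟩
      invFun := fun T => ⟨
        { verts := V
          Adj := T.1.Adj
          adj_sub := fun h => (spanningCoe_induce_top_adj.1 (T.2.1 h)).2.2
          edge_vert := fun h => (spanningCoe_induce_top_adj.1 (T.2.1 h)).1
          symm := T.1.symm }, isMaxSpanningForestOn_iff.2 ⟨rfl, T.2⟩⟩
      left_inv := fun T => Subtype.ext (Subgraph.ext T.2.1.symm rfl)
      right_inv := fun T => rfl }

lemma numSpanningForests_union_le_pow {α : Type*} [Finite α] (G : SimpleGraph α)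
    {V₁ V₂ : Set α} (hdisj : Disjoint V₁ V₂) (h : (V₁ ∪ V₂).Nonempty) :
    numSpanningForests G (V₁ ∪ V₂) ≤ (V₁.ncard + V₂.ncard) ^ crossEdges G V₁ V₂ *
      (numSpanningForests G V₁ * numSpanningForests G V₂) := by
  classical
  set P : Set (α × α) := {p : α × α | p.1 ∈ V₁ ∧ p.2 ∈ V₂ ∧ G.Adj p.1 p.2} with hP
  set s : Finset (Sym2 α) := (Set.toFinite P).toFinset.image (fun p => s(p.1, p.2)) with hs
  have hs_card : s.card ≤ crossEdges G V₁ V₂ := by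
    rw [crossEdges, Set.ncard_eq_toFinset_card _ (Set.toFinite P)]
    exact Finset.card_image_le
  have hdel : ((⊤ : G.Subgraph).induce (V₁ ∪ V₂)).spanningCoe.deleteEdges s =
      ((⊤ : G.Subgraph).induce V₁).spanningCoe ⊔ ((⊤ : G.Subgraph).induce V₂).spanningCoe := by
    ext x y
    have hx : x ∈ V₁ → x ∉ V₂ := fun h => Set.disjoint_left.1 hdisj h
    have hy : y ∈ V₁ → y ∉ V₂ := fun h => Set.disjoint_left.1 hdisj h
    have hsymm := G.adj_comm x y
    have hmem : s(x, y) ∈ (s : Set (Sym2 α)) ↔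
        (x ∈ V₁ ∧ y ∈ V₂ ∧ G.Adj x y) ∨ (y ∈ V₁ ∧ x ∈ V₂ ∧ G.Adj y x) := by
      simp only [hs, hP, Finset.coe_image, Set.Finite.coe_toFinset, Set.mem_image, Prod.exists,
        Set.mem_ofPred_eq, Sym2.eq_iff]
      grind
    rw [deleteEdges_adj, hmem, sup_adj, spanningCoe_induce_top_adj, spanningCoe_induce_top_adj,
      spanningCoe_induce_top_adj, Set.mem_union, Set.mem_union]
    grind
  have hbound := ncard_maxForests_le_deleteEdges_finset h
    (K := ((⊤ : G.Subgraph).induce (V₁ ∪ V₂)).spanningCoe)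
    (fun x y hxy => (spanningCoe_induce_top_adj.1 hxy).1) s
  have hpos : 0 < (V₁ ∪ V₂).ncard := (Set.ncard_pos).2 h
  rw [hdel] at hbound
  simp only [numSpanningForests_eq_ncard]
  rw [← Set.ncard_union_eq hdisj]
  exact hbound.trans (Nat.mul_le_mul (Nat.pow_le_pow_right hpos hs_card)
    (ncard_maxForests_sup_le hdisj (fun x y hxy => (spanningCoe_induce_top_adj.1 hxy).1)
      (fun x y hxy => (spanningCoe_induce_top_adj.1 hxy).1)))

/-- for disjoint connected vertex sets `V₁`, `V₂`,
`H(V₁ ∪ V₂) ≤ H(V₁)·H(V₂)·exp(b(V₁,V₂)·(log|V₁| + log|V₂| + log 2))`. -/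
theorem numSpanningForests_union_le {α : Type*} [Fintype α] (G : SimpleGraph α)
    (V₁ V₂ : Set α) (hdisj : Disjoint V₁ V₂)
    (h1 : V₁.Nonempty) (h2 : V₂.Nonempty)
    (hc1 : (G.induce V₁).Connected) (hc2 : (G.induce V₂).Connected) :
    (numSpanningForests G (V₁ ∪ V₂) : ℝ) ≤
      (numSpanningForests G V₁ : ℝ) * (numSpanningForests G V₂ : ℝ) *
        Real.exp ((crossEdges G V₁ V₂ : ℝ) *
          (Real.log V₁.ncard + Real.log V₂.ncard + Real.log 2)) := by
  have hn1 : (1 : ℝ) ≤ V₁.ncard := by exact_mod_cast (Set.ncard_pos).2 h1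
  have hn2 : (1 : ℝ) ≤ V₂.ncard := by exact_mod_cast (Set.ncard_pos).2 h2
  have hexp : Real.exp ((crossEdges G V₁ V₂ : ℝ) *
      (Real.log V₁.ncard + Real.log V₂.ncard + Real.log 2)) =
      ((V₁.ncard : ℝ) * V₂.ncard * 2) ^ crossEdges G V₁ V₂ := by
    rw [Real.exp_nat_mul, Real.exp_add, Real.exp_add, Real.exp_log (by linarith),
      Real.exp_log (by linarith), Real.exp_log two_pos]
  have hle : (numSpanningForests G (V₁ ∪ V₂) : ℝ) ≤
      ((V₁.ncard : ℝ) + V₂.ncard) ^ crossEdges G V₁ V₂ *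
        (numSpanningForests G V₁ * numSpanningForests G V₂) := by
    exact_mod_cast numSpanningForests_union_le_pow G hdisj (h1.mono Set.subset_union_left)
  rw [hexp, mul_comm]
  refine hle.trans ?_
  gcongr
  nlinarith
end

section
/- Let G be a finite graph and {Vᵢ}ᵢ₌₁^m pairwise disjoint vertex subsets (not necessarily connected). Define H(V) multiplicatively over connected components of G[V] as the product of the number of spanning trees of each component, and define b({Vᵢ}ᵢ₌₁^m) = Σ_{i<j} b(Vᵢ,Vⱼ), the total number of edges between distinct sets. Then Π_{i=1}^m H(Vᵢ) ≤ H(∪ᵢ Vᵢ) ≤ (Π_{i=1}^m H(Vᵢ)) · exp(b({Vᵢ}) · (2·log(Σᵢ|Vᵢ|) + log 2)). -/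
namespace SimpleGraph

variable {α : Type*}

/-- An acyclic graph has at most as many edges as any graph with a coarser reachability relation. -/
theorem IsAcyclic.ncard_edgeSet_le [Finite α] {S T : SimpleGraph α} (hT : T.IsAcyclic)
    (h : ∀ x y, T.Adj x y → S.Reachable x y) : T.edgeSet.ncard ≤ S.edgeSet.ncard := by
  classical
  cases isEmpty_or_nonempty α with
  | inl hα => simp [Set.eq_empty_of_isEmpty]
  | inr hα =>
    obtain ⟨R, hTR, -, hR⟩ := connected_top.exists_isTree_le_of_le_of_isAcyclic (le_top (a := T)) hT
    have hcon : (R \ T ⊔ S).Connected := by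
      refine ⟨fun x y ↦ ?_⟩
      obtain ⟨p⟩ := hR.connected.preconnected x y
      induction p with
      | nil => rfl
      | @cons u v w huv _ ih =>
        refine Reachable.trans ?_ ih
        by_cases hT' : T.Adj u v
        · exact (h _ _ hT').mono le_sup_right
        · exact Adj.reachable (Or.inl ⟨huv, hT'⟩)
    have h₁ := hcon.card_vert_le_card_edgeSet_add_one
    have h₂ := (isTree_iff_connected_and_card.1 hR).2
    rw [Nat.card_coe_set_eq] at h₁ h₂
    rw [edgeSet_sup, edgeSet_sdiff] at h₁
    have h₃ := Set.ncard_union_le (R.edgeSet \ T.edgeSet) S.edgeSet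
    have h₄ := Set.ncard_sdiff_add_ncard_of_subset (edgeSet_mono hTR)
    omega

/-- The supremum of acyclic graphs living on pairwise disjoint vertex sets is acyclic. -/
theorem isAcyclic_iSup_of_pairwise_disjoint {ι : Type*} {V : ι → Set α}
    (hdisj : Pairwise (Function.onFun Disjoint V)) {F : ι → SimpleGraph α}
    (hF : ∀ i, (F i).IsAcyclic) (hV : ∀ i x y, (F i).Adj x y → x ∈ V i) :
    (⨆ i, F i).IsAcyclic := by
  have key : ∀ {u v : α} (p : (⨆ i, F i).Walk u v) (i : ι), u ∈ V i →
      ∀ e ∈ p.edges, e ∈ (F i).edgeSet := by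
    intro u v p
    induction p with
    | nil => simp
    | @cons u v w huv p ih =>
      intro i hi e he
      obtain ⟨j, hj⟩ := iSup_adj.1 huv
      obtain rfl : i = j := by
        by_contra hij
        exact Set.disjoint_left.1 (hdisj hij) hi (hV j _ _ hj)
      rw [Walk.edges_cons, List.mem_cons] at he
      rcases he with rfl | he
      · exact hj
      · exact ih i (hV i _ _ hj.symm) e he
  intro u p hp
  obtain ⟨i, hi⟩ := iSup_adj.1 (p.adj_snd hp.not_nil)
  have hp' := key p i (hV i _ _ hi)
  exact hF i _ (hp.transfer hp')

/-- A graph is a maximal spanning forest of `G` if it is maximal among acyclic subgraphs. -/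
def IsMaxForest (G F : SimpleGraph α) : Prop :=
  Maximal (fun F ↦ F ≤ G ∧ F.IsAcyclic) F

theorem IsMaxForest.le {G F : SimpleGraph α} (h : G.IsMaxForest F) : F ≤ G := h.prop.1

theorem IsMaxForest.isAcyclic {G F : SimpleGraph α} (h : G.IsMaxForest F) : F.IsAcyclic := h.prop.2

theorem IsMaxForest.reachable_eq {G F : SimpleGraph α} (h : G.IsMaxForest F) :
    F.Reachable = G.Reachable :=
  reachable_eq_of_maximal_isAcyclic F h

/-- The subgraph of `G` induced on `V`, as a graph on all vertices. -/
abbrev inducedOn (G : SimpleGraph α) (V : Set α) : SimpleGraph α :=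
  ((⊤ : G.Subgraph).induce V).spanningCoe

theorem inducedOn_adj {G : SimpleGraph α} {V : Set α} {x y : α} :
    (G.inducedOn V).Adj x y ↔ x ∈ V ∧ y ∈ V ∧ G.Adj x y := by
  simp [inducedOn]

theorem inducedOn_mono (G : SimpleGraph α) {V W : Set α} (h : V ⊆ W) :
    G.inducedOn V ≤ G.inducedOn W := by
  intro x y
  simp only [inducedOn_adj]
  exact fun ⟨hx, hy, hxy⟩ ↦ ⟨h hx, h hy, hxy⟩

theorem eq_of_reachable_of_notMem {F : SimpleGraph α} {V : Set α}
    (hV : ∀ x y, F.Adj x y → x ∈ V) {x y : α} (hx : x ∉ V) (h : F.Reachable x y) : x = y := by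
  obtain ⟨p⟩ := h
  cases p with
  | nil => rfl
  | cons hadj _ => exact absurd (hV _ _ hadj) hx

theorem isMaxForest_inducedOn_iff {G F : SimpleGraph α} {V : Set α} (hF : F ≤ G.inducedOn V) :
    (G.inducedOn V).IsMaxForest F ↔ F.IsAcyclic ∧
      ∀ x ∈ V, ∀ y ∈ V, F.Reachable x y ↔ (G.inducedOn V).Reachable x y := by
  refine ⟨fun h ↦ ⟨h.isAcyclic, fun x _ y _ ↦ by rw [h.reachable_eq]⟩, fun ⟨hac, h⟩ ↦ ?_⟩
  refine (maximal_isAcyclic_iff_reachable_eq hF hac).2 ?_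
  have hV : ∀ x y, (G.inducedOn V).Adj x y → x ∈ V := fun x y hxy ↦ (inducedOn_adj.1 hxy).1
  ext x y
  refine ⟨.mono hF, fun hxy ↦ ?_⟩
  by_cases hx : x ∈ V
  · by_cases hy : y ∈ V
    · exact (h x hx y hy).2 hxy
    · rw [eq_of_reachable_of_notMem hV hy hxy.symm]
  · rw [eq_of_reachable_of_notMem hV hx hxy]

/-- Maximal spanning forests on `V`, as subgraphs, correspond to maximal acyclic graphs below the
induced graph. -/
def maxSpanningForestEquiv (G : SimpleGraph α) (V : Set α) :
    {T : G.Subgraph // IsMaxSpanningForestOn G V T} ≃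
      {F : SimpleGraph α // (G.inducedOn V).IsMaxForest F} where
  toFun T := ⟨T.1.spanningCoe, by
    obtain ⟨T, hT, hac, hr⟩ := T
    refine (isMaxForest_inducedOn_iff fun x y hxy ↦ ?_).2 ⟨hac, hr⟩
    exact inducedOn_adj.2 ⟨hT ▸ T.edge_vert hxy, hT ▸ T.edge_vert hxy.symm, T.adj_sub hxy⟩⟩
  invFun F := ⟨{ verts := V
                 Adj := F.1.Adj
                 adj_sub := fun h ↦ (inducedOn_adj.1 (F.2.le h)).2.2
                 edge_vert := fun h ↦ (inducedOn_adj.1 (F.2.le h)).1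
                 symm := F.1.symm }, rfl, (isMaxForest_inducedOn_iff F.2.le).1 F.2⟩
  left_inv T := by
    obtain ⟨T, hT, hac, hr⟩ := T
    exact Subtype.ext (Subgraph.ext hT.symm rfl)
  right_inv F := rfl

theorem numSpanningForests_eq (G : SimpleGraph α) (V : Set α) :
    numSpanningForests G V = Nat.card {F : SimpleGraph α // (G.inducedOn V).IsMaxForest F} :=
  Nat.card_congr (maxSpanningForestEquiv G V)

variable {ι : Type*}

theorem isAcyclic_iSup_isMaxForest {G : SimpleGraph α} {V : ι → Set α}
    (hdisj : Pairwise (Function.onFun Disjoint V)) {F : ι → SimpleGraph α}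
    (hF : ∀ i, (G.inducedOn (V i)).IsMaxForest (F i)) : (⨆ i, F i).IsAcyclic :=
  isAcyclic_iSup_of_pairwise_disjoint hdisj (fun i ↦ (hF i).isAcyclic)
    fun i _ _ h ↦ (inducedOn_adj.1 ((hF i).le h)).1

theorem inducedOn_le_inducedOn_iUnion (G : SimpleGraph α) (V : ι → Set α) (i : ι) :
    G.inducedOn (V i) ≤ G.inducedOn (⋃ i, V i) :=
  G.inducedOn_mono (Set.subset_iUnion V i)

theorem prod_numSpanningForests_le [Finite α] [Fintype ι] (G : SimpleGraph α) (V : ι → Set α)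
    (hdisj : Pairwise (Function.onFun Disjoint V)) :
    ∏ i, numSpanningForests G (V i) ≤ numSpanningForests G (⋃ i, V i) := by
  simp only [numSpanningForests_eq]
  rw [← Nat.card_pi]
  have hex (F : ∀ i, {F : SimpleGraph α // (G.inducedOn (V i)).IsMaxForest F}) :
      ∃ T, (⨆ i, (F i).1) ≤ T ∧ (G.inducedOn (⋃ i, V i)).IsMaxForest T :=
    exists_maximal_isAcyclic_of_le_isAcyclic
      (iSup_le fun i ↦ (F i).2.le.trans (G.inducedOn_le_inducedOn_iUnion V i))
      (isAcyclic_iSup_isMaxForest hdisj fun i ↦ (F i).2)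
  choose T hle hT using hex
  have hrec (F) (i : ι) : (F i).1 = T F ⊓ G.inducedOn (V i) :=
    (F i).2.eq_of_le ⟨inf_le_right, (hT F).isAcyclic.anti inf_le_left⟩
      (le_inf ((le_iSup (fun i ↦ (F i).1) i).trans (hle F)) (F i).2.le)
  refine Nat.card_le_card_of_injective (fun F ↦ ⟨T F, hT F⟩) fun F F' h ↦ funext fun i ↦ ?_
  rw [Subtype.ext_iff, hrec F i, hrec F' i, (Subtype.mk.inj h : T F = T F')]

/-- The edges of `G` joining two distinct members of the family `V`. -/
def crossEdgeSet (G : SimpleGraph α) (V : ι → Set α) : Set (Sym2 α) :=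
  (G.inducedOn (⋃ i, V i)).edgeSet \ (⨆ i, G.inducedOn (V i)).edgeSet

theorem ncard_crossEdgeSet_le [Finite α] [Fintype ι] [LinearOrder ι] (G : SimpleGraph α)
    (V : ι → Set α) :
    (G.crossEdgeSet V).ncard ≤ ∑ i, ∑ j, if i < j then crossEdges G (V i) (V j) else 0 := by
  have hsub : G.crossEdgeSet V ⊆ ⋃ i, ⋃ j, if i < j then
      (fun p : α × α ↦ s(p.1, p.2)) '' {p : α × α | p.1 ∈ V i ∧ p.2 ∈ V j ∧ G.Adj p.1 p.2}
      else ∅ := by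
    intro e
    induction e with
    | h x y =>
      rintro ⟨h, hn⟩
      rw [mem_edgeSet, inducedOn_adj] at h
      obtain ⟨hx, hy, hxy⟩ := h
      obtain ⟨i, hi⟩ := Set.mem_iUnion.1 hx
      obtain ⟨j, hj⟩ := Set.mem_iUnion.1 hy
      simp only [Set.mem_iUnion]
      rcases lt_trichotomy i j with hij | rfl | hij
      · refine ⟨i, j, ?_⟩
        rw [if_pos hij]
        exact ⟨(x, y), ⟨hi, hj, hxy⟩, rfl⟩
      · exact absurd (iSup_adj.2 ⟨i, inducedOn_adj.2 ⟨hi, hj, hxy⟩⟩) hn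
      · refine ⟨j, i, ?_⟩
        rw [if_pos hij]
        exact ⟨(y, x), ⟨hj, hi, hxy.symm⟩, Sym2.eq_swap⟩
  refine (Set.ncard_le_ncard hsub).trans ((Set.ncard_iUnion_le_of_fintype _).trans ?_)
  refine Finset.sum_le_sum fun i _ ↦ (Set.ncard_iUnion_le_of_fintype _).trans ?_
  refine Finset.sum_le_sum fun j _ ↦ ?_
  split_ifs
  · exact Set.ncard_image_le
  · simp

/-- A small set of edges inside `U` is listed, up to loops, by a tuple of pairs of vertices. -/
theorem exists_tuple_of_ncard_le [Finite α] {U : Set α} {D : SimpleGraph α} {c : ℕ}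
    (hD : ∀ x y, D.Adj x y → x ∈ U) (hc : D.edgeSet.ncard ≤ c) (hU : c ≠ 0 → U.Nonempty) :
    ∃ f : Fin c → U × U, D = fromEdgeSet (Set.range fun k ↦ s((f k).1.1, (f k).2.1)) := by
  classical
  rcases Nat.eq_zero_or_pos c with rfl | hpos
  · refine ⟨Fin.elim0, ?_⟩
    have : D.edgeSet = ∅ := (Set.ncard_eq_zero).1 (Nat.le_zero.1 hc)
    rw [← fromEdgeSet_edgeSet D, this, Set.range_eq_empty]
  · obtain ⟨u, hu⟩ := hU hpos.ne'
    have hrep : ∀ e : D.edgeSet, ∃ p : U × U, s(p.1.1, p.2.1) = e.1 := by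
      rintro ⟨e, he⟩
      induction e with
      | h x y => exact ⟨(⟨x, hD x y he⟩, ⟨y, hD y x (Adj.symm he)⟩), rfl⟩
    choose r hr using hrep
    let g := Finite.equivFin D.edgeSet
    refine ⟨fun k ↦ if h : k.1 < Nat.card D.edgeSet then r (g.symm ⟨k, h⟩)
      else (⟨u, hu⟩, ⟨u, hu⟩), ?_⟩
    ext x y
    rw [fromEdgeSet_adj]
    constructor
    · refine fun hxy ↦ ⟨⟨⟨g ⟨s(x, y), hxy⟩, (g _).2.trans_le hc⟩, ?_⟩, hxy.ne⟩
      simp only [Fin.is_lt, dif_pos, hr, Fin.eta]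
      exact congrArg Subtype.val (g.symm_apply_apply ⟨s(x, y), hxy⟩)
    · rintro ⟨⟨k, hk⟩, hne⟩
      by_cases h : k.1 < Nat.card D.edgeSet
      · simp only [h, dif_pos, hr] at hk
        have := (g.symm ⟨k, h⟩).2
        rwa [hk] at this
      · simp only [h, dif_neg, not_false_iff] at hk
        rw [Sym2.eq_iff] at hk
        exact absurd (by grind) hne

theorem numSpanningForests_iUnion_le [Finite α] [Fintype ι] (G : SimpleGraph α) (V : ι → Set α)
    (hdisj : Pairwise (Function.onFun Disjoint V)) :
    numSpanningForests G (⋃ i, V i) ≤ (∏ i, numSpanningForests G (V i)) *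
      (2 * (⋃ i, V i).ncard ^ 2) ^ (G.crossEdgeSet V).ncard := by
  classical
  set U := ⋃ i, V i
  set c := (G.crossEdgeSet V).ncard with hc
  have hex (T : {F : SimpleGraph α // (G.inducedOn U).IsMaxForest F}) (i : ι) :
      ∃ F, T.1 ⊓ G.inducedOn (V i) ≤ F ∧ (G.inducedOn (V i)).IsMaxForest F :=
    exists_maximal_isAcyclic_of_le_isAcyclic inf_le_right (T.2.isAcyclic.anti inf_le_left)
  choose F hle hF using hex
  have hFU (T) : (⨆ i, F T i) ≤ G.inducedOn U :=
    iSup_le fun i ↦ (hF T i).le.trans (G.inducedOn_le_inducedOn_iUnion V i)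
  have hcross (T) : T.1.edgeSet \ (⨆ i, F T i).edgeSet ⊆ T.1.edgeSet ∩ G.crossEdgeSet V := by
    intro e
    induction e with
    | h x y =>
      rintro ⟨h, hn⟩
      refine ⟨h, edgeSet_mono T.2.le h, fun h' ↦ hn ?_⟩
      obtain ⟨i, hi⟩ := iSup_adj.1 h'
      exact iSup_adj.2 ⟨i, hle T i ⟨h, hi⟩⟩
  have hcard (T) : ((⨆ i, F T i) \ T.1).edgeSet.ncard ≤ c := by
    have h₁ : (⨆ i, F T i).edgeSet.ncard ≤ T.1.edgeSet.ncard := by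
      refine (isAcyclic_iSup_isMaxForest hdisj (hF T)).ncard_edgeSet_le fun x y hxy ↦ ?_
      rw [T.2.reachable_eq]
      exact (hFU T hxy).reachable
    rw [edgeSet_sdiff]
    have h₂ : (T.1.edgeSet \ (⨆ i, F T i).edgeSet).ncard ≤ c :=
      Set.ncard_le_ncard ((hcross T).trans Set.inter_subset_right)
    have h₃ := Set.ncard_sdiff_add_ncard T.1.edgeSet (⨆ i, F T i).edgeSet
    have h₄ := Set.ncard_sdiff_add_ncard (⨆ i, F T i).edgeSet T.1.edgeSet
    rw [Set.union_comm] at h₃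
    omega
  have hU : c ≠ 0 → U.Nonempty := by
    intro h
    obtain ⟨e, he⟩ := Set.nonempty_of_ncard_ne_zero h
    induction e with
    | h x y => exact ⟨x, (inducedOn_adj.1 he.1).1⟩
  have htuple (T) := exists_tuple_of_ncard_le
    (fun x y h ↦ (inducedOn_adj.1 (hFU T (sdiff_le (a := ⨆ i, F T i) (b := T.1) h))).1)
    (hcard T) hU
  choose f hf using htuple
  have hrec (T : {F : SimpleGraph α // (G.inducedOn U).IsMaxForest F}) : T.1.edgeSet =
      (T.1.edgeSet ∩ G.crossEdgeSet V) ∪ ((⨆ i, F T i) \ ((⨆ i, F T i) \ T.1)).edgeSet := by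
    have := hcross T
    simp only [edgeSet_sdiff]
    ext e
    have := @this e
    simp only [Set.mem_union, Set.mem_inter_iff, Set.mem_sdiff] at this ⊢
    tauto
  simp only [numSpanningForests_eq]
  calc
    _ ≤ Nat.card ((∀ i, {F : SimpleGraph α // (G.inducedOn (V i)).IsMaxForest F}) ×
        Set (G.crossEdgeSet V) × (Fin c → U × U)) := by
      refine Nat.card_le_card_of_injective
        (fun T ↦ (fun i ↦ ⟨F T i, hF T i⟩, {e | e.1 ∈ T.1.edgeSet}, f T)) fun T T' h ↦ ?_
      simp only [Prod.mk.injEq] at h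
      obtain ⟨hF', hC, hf'⟩ := h
      have hF'' : F T = F T' := funext fun i ↦ congrArg Subtype.val (congrFun hF' i)
      refine Subtype.ext (edgeSet_inj.1 ?_)
      rw [hrec T, hrec T', hf T, hf T', hF'', hf']
      congr 1
      ext e
      rw [Set.mem_inter_iff, Set.mem_inter_iff, and_congr_left_iff]
      exact fun he ↦ Set.ext_iff.1 hC ⟨e, he⟩
    _ = _ := by
      have := Fintype.ofFinite (G.crossEdgeSet V)
      rw [Nat.card_prod, Nat.card_prod, Nat.card_pi, Nat.card_fun, Nat.card_prod, Nat.card_fin,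
        Nat.card_eq_fintype_card (α := Set _), Fintype.card_set, ← Nat.card_eq_fintype_card,
        Nat.card_coe_set_eq, Nat.card_coe_set_eq, ← hc, mul_pow, mul_pow, sq, mul_pow]

end SimpleGraph

theorem two_mul_sq_pow_le_exp {n c b : ℕ} (hcb : c ≤ b) :
    ((2 * n ^ 2) ^ c : ℝ) ≤ Real.exp (b * (2 * Real.log n + Real.log 2)) := by
  have hlog : 0 ≤ Real.log n := Real.log_natCast_nonneg n
  have hlog2 : 0 ≤ Real.log 2 := Real.log_nonneg one_le_two
  rcases Nat.eq_zero_or_pos n with rfl | hn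
  · refine le_trans ?_ (Real.one_le_exp (by positivity))
    rcases Nat.eq_zero_or_pos c with rfl | hc
    · simp
    · simp [hc.ne']
  · have hn' : (0 : ℝ) < n := by exact_mod_cast hn
    have : (2 * n ^ 2 : ℝ) = Real.exp (2 * Real.log n + Real.log 2) := by
      rw [Real.exp_add, two_mul (Real.log n), Real.exp_add, Real.exp_log hn', Real.exp_log two_pos]
      ring
    rw [this, ← Real.exp_nat_mul]
    gcongr

/-- for pairwise disjoint vertex sets `V₁,…,V_m` (not necessarily
connected), with `b({Vᵢ}) = Σ_{i<j} b(Vᵢ,Vⱼ)`,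
`Π H(Vᵢ) ≤ H(∪ Vᵢ) ≤ (Π H(Vᵢ))·exp(b({Vᵢ})·(2 log Σ|Vᵢ| + log 2))`. -/
theorem numSpanningForests_iUnion_bounds {α : Type*} [Fintype α] (G : SimpleGraph α)
    (m : ℕ) (V : Fin m → Set α)
    (hdisj : Pairwise (Function.onFun Disjoint V)) :
    (∏ i, numSpanningForests G (V i)) ≤ numSpanningForests G (⋃ i, V i) ∧
      (numSpanningForests G (⋃ i, V i) : ℝ) ≤
        (∏ i, (numSpanningForests G (V i) : ℝ)) *
          Real.exp ((∑ i, ∑ j, if i < j then (crossEdges G (V i) (V j) : ℝ) else 0) *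
            (2 * Real.log (∑ i, ((V i).ncard : ℝ)) + Real.log 2)) := by
  refine ⟨SimpleGraph.prod_numSpanningForests_le G V hdisj, ?_⟩
  have hn : (⋃ i, V i).ncard = ∑ i, (V i).ncard := by
    rw [← finsum_eq_sum_of_fintype]
    exact Set.ncard_iUnion_of_finite (fun i ↦ (V i).toFinite) hdisj
  have hb := two_mul_sq_pow_le_exp (n := (⋃ i, V i).ncard) (G.ncard_crossEdgeSet_le V)
  rw [hn] at hb
  push_cast at hb
  have h := G.numSpanningForests_iUnion_le V hdisj
  rw [hn] at h
  have h' := (Nat.cast_le (α := ℝ)).2 h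
  push_cast at h'
  exact h'.trans (mul_le_mul_of_nonneg_left hb (by positivity))
end
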